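/- Let G be a bipartite graph with parts X and Y, and let (S,T) be a minimum barrier of G. Then: (a) for each T-even component C of G − (S ∪ T), the number of edges of G between T and C is zero; and (b) for each T-odd component C of G − (S ∪ T) and each u ∈ T, there is at most one edge of G between u and C. -/

import Mathlib

open Finset SimpleGraph

attribute [local instance] Classical.propDecidable

/-- The degree of `v` in `G − S`, the graph obtained from `G` by deleting the vertices
of `S` (and all incident edges): the number of neighbors of `v` outside `S`. -/
noncomputable def degDel {V : Type*} (G : SimpleGraph V) (S : Finset V) (v : V) : ℕ :=
  Nat.card {w : V // G.Adj v w ∧ w ∉ S}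

/-- The graph `G − R` obtained by deleting the vertices of `R`, as a graph on the
subtype of vertices not in `R`. -/
def delGraph {V : Type*} (G : SimpleGraph V) (R : Finset V) :
    SimpleGraph {v : V // v ∉ R} :=
  G.comap Subtype.val

/-- `ε_G(T, C)`: the number of edges of `G` with one endpoint in `T` and the other in
the connected component `C` of `G − (S ∪ T)`. -/
noncomputable def epsTC {V : Type*} [DecidableEq V] (G : SimpleGraph V) (S T : Finset V)
    (C : (delGraph G (S ∪ T)).ConnectedComponent) : ℕ :=
  Nat.card {p : V × {v : V // v ∉ S ∪ T} //
    p.1 ∈ T ∧ G.Adj p.1 p.2.1 ∧ (delGraph G (S ∪ T)).connectedComponentMk p.2 = C}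

/-- `q(S, T)`: the number of `T`-odd components of `G − (S ∪ T)`, i.e. components `C`
with `ε_G(T, C)` odd. -/
noncomputable def qST {V : Type*} [DecidableEq V] (G : SimpleGraph V) (S T : Finset V) : ℕ :=
  Nat.card {C : (delGraph G (S ∪ T)).ConnectedComponent // Odd (epsTC G S T C)}

/-- `δ(S, T) = 2|S| + Σ_{v ∈ T} deg_{G−S}(v) − 2|T ∩ X| − q(S, T)`, as an integer. -/
noncomputable def eulerDelta {V : Type*} [DecidableEq V] (G : SimpleGraph V)
    (X S T : Finset V) : ℤ :=
  2 * (S.card : ℤ) + (∑ v ∈ T, (degDel G S v : ℤ)) - 2 * ((T ∩ X).card : ℤ)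
    - (qST G S T : ℤ)

/-- `(S, T)` is a barrier of the bipartite graph `G` with parts `X`, `Y`:
`S ⊆ X`, `T ⊆ X ∪ Y`, `S ∩ T = ∅`, and `δ(S, T) < 0`. -/
def IsBarrier {V : Type*} [DecidableEq V] (G : SimpleGraph V) (X Y S T : Finset V) : Prop :=
  S ⊆ X ∧ T ⊆ X ∪ Y ∧ Disjoint S T ∧ eulerDelta G X S T < 0

/-- A minimum barrier: a barrier whose size `|S ∪ T|` is as small as possible. -/
def IsMinBarrier {V : Type*} [DecidableEq V] (G : SimpleGraph V) (X Y S T : Finset V) :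
    Prop :=
  IsBarrier G X Y S T ∧
    ∀ S' T' : Finset V, IsBarrier G X Y S' T' → (S ∪ T).card ≤ (S' ∪ T').card

/-- `ε_G(u, C)`: the number of edges of `G` between the vertex `u` and the connected
component `C` of `G − (S ∪ T)`. -/
noncomputable def epsUC {V : Type*} [DecidableEq V] (G : SimpleGraph V) (S T : Finset V)
    (u : V) (C : (delGraph G (S ∪ T)).ConnectedComponent) : ℕ :=
  Nat.card {w : {v : V // v ∉ S ∪ T} //
    G.Adj u w.1 ∧ (delGraph G (S ∪ T)).connectedComponentMk w = C}

theorem even_card_adj_pairs {V : Type*} (G : SimpleGraph V) (T : Finset V) :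
    Even ((T ×ˢ T).filter fun p => G.Adj p.1 p.2).card := by
  rw [← ZMod.natCast_eq_zero_iff_even, Finset.card_eq_sum_ones, Nat.cast_sum]
  refine Finset.sum_involution (fun p _ => p.swap) ?_ ?_ ?_ ?_
  · intros; decide
  · rintro ⟨a, b⟩ h _ hs
    simp only [mem_filter, Prod.swap_prod_mk, Prod.mk.injEq] at h hs
    exact h.2.ne hs.2
  · rintro ⟨a, b⟩ h
    simp only [mem_filter, mem_product, Prod.swap_prod_mk] at h ⊢
    exact ⟨h.1.symm, h.2.symm⟩
  · intros; simp

section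
variable {V : Type*} [DecidableEq V] {G : SimpleGraph V} {S T : Finset V} {u : V}

/-- The number of edges between a vertex set and the rest, counted through the components. -/
theorem sum_epsTC [Fintype V] (G : SimpleGraph V) (S T : Finset V) :
    ∑ C, epsTC G S T C =
      Nat.card {p : V × {v : V // v ∉ S ∪ T} // p.1 ∈ T ∧ G.Adj p.1 p.2.1} := by
  simp only [epsTC]
  rw [← Nat.card_sigma]
  refine Nat.card_congr
    { toFun := fun x => ⟨x.2.1, x.2.2.1, x.2.2.2.1⟩
      invFun := fun p => ⟨(delGraph G (S ∪ T)).connectedComponentMk p.1.2,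
        p.1, p.2.1, p.2.2, rfl⟩
      left_inv := ?_
      right_inv := fun _ => rfl }
  rintro ⟨_, p, h, h', rfl⟩
  rfl

theorem degDel_eq_add [Fintype V] (hST : Disjoint S T) (v : V) :
    degDel G S v = (T.filter fun w => G.Adj v w).card
      + (univ.filter fun w => G.Adj v w ∧ w ∉ S ∪ T).card := by
  rw [degDel, Nat.card_eq_fintype_card, Fintype.card_subtype,
    ← Finset.card_union_of_disjoint]
  · congr 1
    ext w
    have : w ∈ T → w ∉ S := fun h => Finset.disjoint_right.mp hST h
    simp only [mem_filter, mem_union, mem_univ, true_and]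
    tauto
  · refine Finset.disjoint_left.mpr fun w h h' => ?_
    simp only [mem_filter, mem_union] at h h'
    tauto

theorem even_eulerDelta [Fintype V] (X : Finset V) (hST : Disjoint S T) :
    Even (eulerDelta G X S T) := by
  have hin : ∑ v ∈ T, (T.filter fun w => G.Adj v w).card
      = ((T ×ˢ T).filter fun p => G.Adj p.1 p.2).card := by
    rw [Finset.card_filter, Finset.sum_product]
    simp only [Finset.card_filter]
  have hout : ∑ v ∈ T, (univ.filter fun w => G.Adj v w ∧ w ∉ S ∪ T).card
      = ∑ C, epsTC G S T C := by
    rw [sum_epsTC, ← Finset.card_sigma, Nat.card_eq_fintype_card, Fintype.card_subtype]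
    refine (Finset.card_bij (fun p _ => ⟨p.1, p.2.1⟩) ?_ ?_ ?_).symm
    · intro p hp
      simp only [mem_filter, mem_univ, true_and, mem_sigma] at hp ⊢
      exact ⟨hp.1, hp.2, p.2.2⟩
    · rintro ⟨a, b⟩ _ ⟨a', b'⟩ _ h
      simp only [Sigma.mk.injEq, heq_eq_eq] at h
      exact Prod.ext h.1 (Subtype.ext h.2)
    · rintro ⟨a, b⟩ h
      simp only [mem_sigma, mem_filter, mem_univ, true_and] at h
      exact ⟨(a, ⟨b, h.2.2⟩), by simpa using ⟨h.1, h.2.1⟩, rfl⟩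
  have hodd : Even ((∑ C, epsTC G S T C) + qST G S T) := by
    rw [qST, Nat.card_eq_fintype_card, Fintype.card_subtype, Nat.even_add,
      ← Nat.not_odd_iff_even, ← Nat.not_odd_iff_even, Finset.odd_sum_iff_odd_card_odd]
  have hsum : ∑ v ∈ T, degDel G S v = _ :=
    (Finset.sum_congr rfl fun v _ => degDel_eq_add hST v).trans
      (Finset.sum_add_distrib.trans (congrArg₂ (· + ·) hin hout))
  obtain ⟨a, ha⟩ := even_card_adj_pairs G T
  obtain ⟨b, hb⟩ := hodd
  rw [eulerDelta, ← Nat.cast_sum, hsum, ha]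
  rw [Int.even_iff]
  omega

/-- The inclusion of `G - (S ∪ T)` into the graph where `u` is put back. -/
def delGraphErase (G : SimpleGraph V) (S T : Finset V) (u : V) :
    delGraph G (S ∪ T) →g delGraph G (S ∪ T.erase u) where
  toFun w := ⟨w.1, fun h => w.2 (Finset.union_subset_union_right (Finset.erase_subset u T) h)⟩
  map_rel' h := h

theorem connectedComponentMk_eq_map_delGraphErase_iff
    {C : (delGraph G (S ∪ T)).ConnectedComponent}
    (hC : ∀ w, (delGraph G (S ∪ T)).connectedComponentMk w = C → ¬ G.Adj u w.1)
    (x : {v : V // v ∉ S ∪ T.erase u}) :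
    (delGraph G (S ∪ T.erase u)).connectedComponentMk x = C.map (delGraphErase G S T u) ↔
      ∃ w, (delGraph G (S ∪ T)).connectedComponentMk w = C ∧ delGraphErase G S T u w = x := by
  constructor
  · induction C using ConnectedComponent.ind with | _ c
    intro h
    rw [ConnectedComponent.map_mk, ConnectedComponent.eq] at h
    obtain ⟨p⟩ := h.symm
    have key : ∀ {y z} (p : (delGraph G (S ∪ T.erase u)).Walk y z),
        (∃ w, (delGraph G (S ∪ T)).connectedComponentMk w
          = (delGraph G (S ∪ T)).connectedComponentMk c ∧ delGraphErase G S T u w = y) →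
        ∃ w, (delGraph G (S ∪ T)).connectedComponentMk w
          = (delGraph G (S ∪ T)).connectedComponentMk c ∧ delGraphErase G S T u w = z := by
      intro y z p
      induction p with
      | nil => exact id
      | @cons y y' z hadj p ih =>
        rintro ⟨w, hw, rfl⟩
        apply ih
        have hadj' : G.Adj w.1 y'.1 := hadj
        have hy : y'.1 ∉ S ∪ T := by
          intro hmem
          have hy' := y'.2
          have : y'.1 = u := by
            simp only [mem_union, mem_erase] at hmem hy'
            tauto
          exact hC w hw (this ▸ hadj'.symm)
        refine ⟨⟨y'.1, hy⟩, ?_, rfl⟩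
        rw [← hw]
        exact ConnectedComponent.sound
          (SimpleGraph.Adj.reachable (G := delGraph G (S ∪ T)) hadj'.symm)
    exact key p ⟨c, rfl, rfl⟩
  · rintro ⟨w, rfl, rfl⟩
    rfl

theorem delGraphErase_injective : Function.Injective (delGraphErase G S T u) :=
  by
  intro _ _ h
  have hval := congrArg Subtype.val h
  exact Subtype.ext hval

theorem epsTC_map_delGraphErase
    {C : (delGraph G (S ∪ T)).ConnectedComponent}
    (hC : ∀ w, (delGraph G (S ∪ T)).connectedComponentMk w = C → ¬ G.Adj u w.1) :
    epsTC G S (T.erase u) (C.map (delGraphErase G S T u)) = epsTC G S T C := by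
  symm
  refine Nat.card_eq_of_bijective (fun p => ⟨(p.1.1, delGraphErase G S T u p.1.2), ?_, p.2.2.1,
      (connectedComponentMk_eq_map_delGraphErase_iff hC _).mpr ⟨_, p.2.2.2, rfl⟩⟩) ⟨?_, ?_⟩
  · refine Finset.mem_erase.mpr ⟨?_, p.2.1⟩
    intro h
    exact hC _ p.2.2.2 (h ▸ p.2.2.1)
  · rintro ⟨⟨a, b⟩, _⟩ ⟨⟨a', b'⟩, _⟩ h
    simp only [Subtype.mk.injEq, Prod.mk.injEq] at h
    obtain ⟨rfl, h⟩ := h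
    cases delGraphErase_injective h
    rfl
  · rintro ⟨⟨a, b⟩, ha, hab, hb⟩
    obtain ⟨w, hw, rfl⟩ := (connectedComponentMk_eq_map_delGraphErase_iff hC _).mp hb
    exact ⟨⟨(a, w), Finset.mem_of_mem_erase ha, hab, hw⟩, rfl⟩

/-- Removing `u` from `T` destroys at most the `T`-odd components adjacent to `u`. -/
theorem qST_le_erase [Finite V] (G : SimpleGraph V) (S T : Finset V) (u : V) :
    qST G S T ≤ qST G S (T.erase u) +
      Nat.card {C : (delGraph G (S ∪ T)).ConnectedComponent // Odd (epsTC G S T C) ∧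
        ∃ w, (delGraph G (S ∪ T)).connectedComponentMk w = C ∧ G.Adj u w.1} := by
  rw [qST, qST, ← Nat.card_sum]
  refine Nat.card_le_card_of_injective (fun C =>
    if h : ∃ w, (delGraph G (S ∪ T)).connectedComponentMk w = C.1 ∧ G.Adj u w.1 then
      Sum.inr ⟨C.1, C.2, h⟩
    else Sum.inl ⟨C.1.map (delGraphErase G S T u), by
      rw [epsTC_map_delGraphErase (by simpa using h)]; exact C.2⟩) ?_
  rintro ⟨C, hC⟩ ⟨D, hD⟩ h
  by_cases h₁ : ∃ w, (delGraph G (S ∪ T)).connectedComponentMk w = C ∧ G.Adj u w.1 <;>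
  by_cases h₂ : ∃ w, (delGraph G (S ∪ T)).connectedComponentMk w = D ∧ G.Adj u w.1
  · simpa [h₁, h₂] using h
  · simp [h₁, h₂] at h
  · simp [h₁, h₂] at h
  · simp only [h₁, h₂, dite_false, Sum.inl.injEq, Subtype.mk.injEq] at h
    rw [Subtype.mk.injEq]
    obtain ⟨w, rfl⟩ := C.exists_rep
    obtain ⟨w', hw', e⟩ := (connectedComponentMk_eq_map_delGraphErase_iff (by simpa using h₂)
      (delGraphErase G S T u w)).mp h
    rw [← hw', delGraphErase_injective e]
    rfl

theorem eulerDelta_erase_le [Finite V] (X : Finset V) (hu : u ∈ T) :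
    eulerDelta G X S (T.erase u) + degDel G S u ≤ eulerDelta G X S T + 2 +
      Nat.card {C : (delGraph G (S ∪ T)).ConnectedComponent // Odd (epsTC G S T C) ∧
        ∃ w, (delGraph G (S ∪ T)).connectedComponentMk w = C ∧ G.Adj u w.1} := by
  have hq := qST_le_erase G S T u
  have hsum := Finset.sum_erase_add T (fun v => (degDel G S v : ℤ)) hu
  have hX : (T ∩ X).card ≤ ((T.erase u) ∩ X).card + 1 := by
    rw [Finset.erase_inter]
    have := Finset.pred_card_le_card_erase (s := T ∩ X) (a := u)
    omega
  unfold eulerDelta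
  omega

theorem IsMinBarrier.degDel_le [Fintype V] {X Y : Finset V} (hmin : IsMinBarrier G X Y S T)
    (hu : u ∈ T) :
    degDel G S u ≤
      Nat.card {C : (delGraph G (S ∪ T)).ConnectedComponent // Odd (epsTC G S T C) ∧
        ∃ w, (delGraph G (S ∪ T)).connectedComponentMk w = C ∧ G.Adj u w.1} := by
  obtain ⟨⟨hS, hT, hST, hneg⟩, hle⟩ := hmin
  have hnot : ¬ eulerDelta G X S (T.erase u) < 0 := by
    intro h
    have := hle S (T.erase u) ⟨hS, (Finset.erase_subset u T).trans hT,
      hST.mono_right (Finset.erase_subset u T), h⟩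
    rw [Finset.card_union_of_disjoint hST, Finset.card_union_of_disjoint
      (hST.mono_right (Finset.erase_subset u T))] at this
    have := Finset.card_erase_lt_of_mem hu
    omega
  obtain ⟨a, ha⟩ := even_eulerDelta (G := G) X hST
  have := eulerDelta_erase_le (G := G) (S := S) X hu
  omega

/-- In a minimum barrier, the neighbors of `u ∈ T` outside `S` lie in pairwise distinct
`T`-odd components. -/
theorem IsMinBarrier.odd_and_unique [Fintype V] {X Y : Finset V}
    (hmin : IsMinBarrier G X Y S T) (hu : u ∈ T) {w : {v : V // v ∉ S ∪ T}}
    (hw : G.Adj u w.1) :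
    Odd (epsTC G S T ((delGraph G (S ∪ T)).connectedComponentMk w)) ∧
      ∀ w' : {v : V // v ∉ S ∪ T}, G.Adj u w'.1 →
        (delGraph G (S ∪ T)).connectedComponentMk w' =
          (delGraph G (S ∪ T)).connectedComponentMk w → w' = w := by
  have hdeg := hmin.degDel_le hu
  set K := {C : (delGraph G (S ∪ T)).ConnectedComponent // Odd (epsTC G S T C) ∧
        ∃ w, (delGraph G (S ∪ T)).connectedComponentMk w = C ∧ G.Adj u w.1}
  choose g hg hadj using fun C : K => C.2.2
  let f : K → {w : V // G.Adj u w ∧ w ∉ S} := fun C =>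
    ⟨(g C).1, hadj C, fun h => (g C).2 (Finset.mem_union_left T h)⟩
  have hf : Function.Injective f := by
    intro C D h
    have hval := congrArg Subtype.val h
    have hg' : g C = g D := Subtype.ext hval
    exact Subtype.ext (by rw [← hg C, ← hg D, hg'])
  have hsurj : Function.Surjective f :=
    (hf.bijective_of_nat_card_le hdeg).2
  have hcov : ∀ x : {v : V // v ∉ S ∪ T}, G.Adj u x.1 → ∃ C, g C = x := fun x hx => by
    obtain ⟨C, hC⟩ := hsurj ⟨x.1, hx, fun h => x.2 (Finset.mem_union_left T h)⟩
    have hval := congrArg Subtype.val hC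
    exact ⟨C, Subtype.ext hval⟩
  obtain ⟨C, rfl⟩ := hcov w hw
  refine ⟨by rw [hg C]; exact C.2.1, fun w' hw' h => ?_⟩
  obtain ⟨D, rfl⟩ := hcov w' hw'
  rw [hg, hg] at h
  rw [Subtype.ext h]

end

/-- **Lemma 2.3(ii),(iii).** Let `(S, T)` be a minimum barrier of a finite bipartite
graph `G` with parts `X`, `Y`.  Then (a) every `T`-even component `C` of `G − (S ∪ T)`
satisfies `ε_G(T, C) = 0`, and (b) for every `T`-odd component `C` of `G − (S ∪ T)` and
every `u ∈ T` there is at most one edge of `G` between `u` and `C`. -/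
theorem minBarrier_components {V : Type*} [Fintype V] [DecidableEq V] (G : SimpleGraph V)
    (X Y S T : Finset V)
    (hpart : X ∪ Y = Finset.univ) (hXY : Disjoint X Y)
    (hbip : ∀ u v, G.Adj u v → (u ∈ X ↔ v ∈ Y))
    (hmin : IsMinBarrier G X Y S T) :
    (∀ C : (delGraph G (S ∪ T)).ConnectedComponent,
        ¬ Odd (epsTC G S T C) → epsTC G S T C = 0) ∧
    (∀ C : (delGraph G (S ∪ T)).ConnectedComponent,
        Odd (epsTC G S T C) → ∀ u ∈ T, epsUC G S T u C ≤ 1) := by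
  refine ⟨fun C hC => ?_, fun C _ u hu => ?_⟩
  · rw [epsTC, Nat.card_eq_zero]
    refine Or.inl ⟨?_⟩
    rintro ⟨⟨t, w⟩, ht, hadj, rfl⟩
    exact hC (hmin.odd_and_unique ht hadj).1
  · rw [epsUC, Finite.card_le_one_iff_subsingleton]
    refine ⟨?_⟩
    rintro ⟨w, hw, hC⟩ ⟨w', hw', hC'⟩
    exact Subtype.ext ((hmin.odd_and_unique hu hw').2 w hw (hC.trans hC'.symm))
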